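/- arXiv:2208.06989 — 2 statements merged into one kernel-verified Lean document; each statement's English description precedes it below -/
import Mathlib

section
/- Let k ≥ 2 and let φ₁, …, φ_k be the k (distinct) complex roots of the characteristic polynomial x^k − x^{k−1} − ⋯ − x − 1 of the k-bonacci recursion. Let the k-bonacci numbers F⁽ᵏ⁾_n be defined by F⁽ᵏ⁾_n = 0 for 0 ≤ n < k−1, F⁽ᵏ⁾_{k−1} = 1, and F⁽ᵏ⁾_{n+1} = Σ_{m=0}^{k−1} F⁽ᵏ⁾_{n+1−k+m} for n ≥ k−1. Then for every n ≥ 0, F⁽ᵏ⁾_n = Σ_{i=1}^{k} φ_i^n / Π_{j≠i} (φ_i − φ_j). -/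
open Finset

/-- Power sums weighted by the inverse nodal products: they vanish for exponents below
`k - 1` and equal one at `k - 1`. -/
theorem sum_pow_div_prod_sub {K : Type*} [Field K] {k : ℕ} {φ : Fin k → K}
    (hinj : Function.Injective φ) {n : ℕ} (hn : n < k) :
    ∑ i, φ i ^ n / ∏ j ∈ Finset.univ.erase i, (φ i - φ j) = if n = k - 1 then 1 else 0 := by
  have h := Lagrange.coeff_eq_sum (s := Finset.univ) (v := φ) (P := Polynomial.X ^ n)
    hinj.injOn (by simpa [Polynomial.degree_X_pow] using hn)
  simp only [Polynomial.eval_pow, Polynomial.eval_X, Polynomial.coeff_X_pow,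
    Finset.card_univ, Fintype.card_fin] at h
  rw [← h]
  simp only [eq_comm]

/-- The generalized Binet formula for the `k`-bonacci numbers: if `φ 0, …, φ (k-1)`
are the `k` distinct complex roots of `x^k = x^(k-1) + ⋯ + x + 1`, and `F` is the
`k`-bonacci sequence (zero for `n < k-1`, one at `n = k-1`, then each term the sum of the
previous `k` terms), then `F n = ∑ i, φ i ^ n / ∏_{j ≠ i} (φ i - φ j)`. -/
theorem kbonacci_binet (k : ℕ) (hk : 2 ≤ k) (φ : Fin k → ℂ)
    (hinj : Function.Injective φ)
    (hroot : ∀ i, φ i ^ k = ∑ m ∈ Finset.range k, φ i ^ m)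
    (F : ℕ → ℂ)
    (hF0 : ∀ n, n < k - 1 → F n = 0)
    (hF1 : F (k - 1) = 1)
    (hFrec : ∀ n, k - 1 ≤ n → F (n + 1) = ∑ m ∈ Finset.range k, F (n + 1 - k + m)) :
    ∀ n : ℕ, F n = ∑ i, φ i ^ n / ∏ j ∈ Finset.univ.erase i, (φ i - φ j) := by
  intro n
  induction n using Nat.strong_induction_on with
  | _ n ih =>
    rcases lt_or_ge n k with hn | hn
    · rw [sum_pow_div_prod_sub hinj hn]
      split_ifs with h
      · rw [h, hF1]
      · exact hF0 n (by omega)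
    · obtain ⟨d, rfl⟩ := Nat.exists_eq_add_of_le' hn
      have hrec : F (d + k) = ∑ m ∈ Finset.range k, F (d + m) := by
        have h := hFrec (d + k - 1) (by omega)
        rwa [show d + k - 1 + 1 = d + k by omega, Nat.add_sub_cancel] at h
      rw [hrec, Finset.sum_congr rfl fun m hm =>
        ih (d + m) (by have := Finset.mem_range.mp hm; omega), Finset.sum_comm]
      refine Finset.sum_congr rfl fun i _ => ?_
      rw [← Finset.sum_div, pow_add, hroot, Finset.mul_sum]
      simp only [pow_add]
end

section
/- For every k ≥ 2, the polynomial x^k − x^{k−1} − x^{k−2} − ⋯ − x − 1 has no repeated roots; equivalently, its k roots in ℂ are pairwise distinct (the polynomial is separable). -/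
open Polynomial in
/-- A common root of the `k`-bonacci characteristic polynomial and its derivative forces an
integer identity, obtained from the multiple `X ^ (k + 1) - 2 * X ^ k + 1`. -/
theorem kbonacci_nat_identity_of_double_root {k : ℕ} {a : ℂ}
    (h : (X ^ k - ∑ i ∈ Finset.range k, X ^ i : ℂ[X]).eval a = 0)
    (h' : (derivative (X ^ k - ∑ i ∈ Finset.range k, X ^ i : ℂ[X])).eval a = 0) :
    (2 * k) ^ k * 2 = (k + 1) ^ (k + 1) := by
  have hmul : (X ^ k - ∑ i ∈ Finset.range k, X ^ i : ℂ[X]) * (X - 1)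
      = X ^ (k + 1) - 2 * X ^ k + 1 := by
    rw [sub_mul, geom_sum_mul]
    ring
  have hroot : a ^ (k + 1) - 2 * a ^ k + 1 = 0 := by
    simpa [h] using (congrArg (eval a) hmul).symm
  have hderiv : (k + 1) * a ^ k - 2 * (k * a ^ (k - 1)) = 0 := by
    have := congrArg (fun p => eval a (derivative p)) hmul
    simp only [derivative_mul, eval_add, eval_mul, h, h'] at this
    simpa [derivative_X_pow] using this.symm
  have ha : (k + 1) * a = 2 * k := by
    rcases k with _ | k
    · norm_num at hderiv
    have ha0 : a ≠ 0 := by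
      rintro rfl
      simp at hroot
    apply mul_right_cancel₀ (pow_ne_zero k ha0)
    simp only [Nat.add_sub_cancel] at hderiv
    linear_combination hderiv
  have hcast : (2 * k : ℂ) ^ k * 2 = (k + 1) ^ (k + 1) := by
    have hlin : (2 : ℂ) = (k + 1) * (2 - a) := by linear_combination ha
    calc (2 * k : ℂ) ^ k * 2 = ((k + 1) * a) ^ k * ((k + 1) * (2 - a)) := by rw [ha, ← hlin]
      _ = (k + 1) ^ (k + 1) := by
        rw [mul_pow]
        linear_combination (-(k + 1 : ℂ) ^ (k + 1)) * hroot
  exact_mod_cast hcast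

/-- For every `k ≥ 2`, the characteristic polynomial `x^k - x^(k-1) - ⋯ - x - 1` of the
`k`-bonacci recursion is separable over `ℂ`: its roots are pairwise distinct. -/
theorem kbonacci_charPoly_separable (k : ℕ) (hk : 2 ≤ k) :
    ((Polynomial.X ^ k - ∑ i ∈ Finset.range k, Polynomial.X ^ i : Polynomial ℂ)).Separable := by
  rw [Polynomial.separable_def,
    Polynomial.isCoprime_iff_aeval_ne_zero_of_isAlgClosed (k := ℂ) (K := ℂ)]
  intro a
  by_contra! hroots
  simp only [Polynomial.coe_aeval_eq_eval] at hroots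
  have hid := kbonacci_nat_identity_of_double_root hroots.1 hroots.2
  have hdvd : k ∣ (k + 1) ^ (k + 1) :=
    hid ▸ ((dvd_mul_left k 2).trans (dvd_pow_self _ (by lia))).mul_right 2
  have hcop : Nat.Coprime k ((k + 1) ^ (k + 1)) := Nat.Coprime.pow_right _ (by simp)
  have := hcop.eq_one_of_dvd hdvd
  lia
end
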